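/- arXiv:1308.4628 — 2 statements merged into one kernel-verified Lean document; each statement's English description precedes it below -/
import Mathlib

section
/- Let p be a prime, q a power of p, and n ≥ 1. Let K be a field which, in case its characteristic is different from p, contains a primitive p-th root of unity. Then every nonzero module M over K for the group G(n) = GL_n(F_q) (whether finite or infinite dimensional over K) has a one-dimensional K-subspace that is invariant under the subgroup U(n) of upper unitriangular matrices. -/
open Matrix

/-- In a finite group, a set containing `1` and closed under multiplication is
closed under inverses. -/
lemma inv_mem_of_one_mem_of_mul_mem {G : Type*} [Group G] [Finite G] {S : Set G}
    (h1 : (1 : G) ∈ S) (hmul : ∀ {a b : G}, a ∈ S → b ∈ S → a * b ∈ S) {a : G}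
    (ha : a ∈ S) : a⁻¹ ∈ S := by
  have hpow : ∀ m : ℕ, a ^ m ∈ S := by
    intro m
    induction m with
    | zero => simpa using h1
    | succ k ih => rw [pow_succ]; exact hmul ih ha
  have hcard : a ^ Nat.card G = 1 := pow_card_eq_one'
  have hpos : 0 < Nat.card G := Nat.card_pos
  have hinv : a⁻¹ = a ^ (Nat.card G - 1) := by
    symm
    apply eq_inv_of_mul_eq_one_right
    rw [← pow_succ', Nat.sub_add_cancel hpos]
    exact hcard
  rw [hinv]
  exact hpow _

section GLBasics

variable (F : Type) [Field F] [Fintype F] [DecidableEq F] (n : ℕ)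

/-- The subgroup `B` of invertible upper triangular matrices (the standard Borel). -/
def BT : Subgroup (GL (Fin n) F) where
  carrier := {A | (A : Matrix (Fin n) (Fin n) F).BlockTriangular id}
  one_mem' := Matrix.blockTriangular_one
  mul_mem' := by
    intro a b ha hb
    simpa [Units.val_mul] using Matrix.BlockTriangular.mul ha hb
  inv_mem' := by
    intro a ha
    exact inv_mem_of_one_mem_of_mul_mem
      (S := {A : GL (Fin n) F | (A : Matrix (Fin n) (Fin n) F).BlockTriangular id})
      Matrix.blockTriangular_one
      (fun hx hy => by simpa [Units.val_mul] using Matrix.BlockTriangular.mul hx hy) ha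

/-- The subgroup `U` of upper unitriangular matrices. -/
def UT : Subgroup (GL (Fin n) F) where
  carrier := {A | (A : Matrix (Fin n) (Fin n) F).BlockTriangular id ∧
      ∀ i, (A : Matrix (Fin n) (Fin n) F) i i = 1}
  one_mem' := ⟨Matrix.blockTriangular_one, fun i => Matrix.one_apply_eq i⟩
  mul_mem' := by
    rintro a b ⟨ha1, ha2⟩ ⟨hb1, hb2⟩
    refine ⟨by simpa [Units.val_mul] using ha1.mul hb1, ?_⟩
    intro i
    rw [Units.val_mul, Matrix.mul_apply]
    rw [Finset.sum_eq_single i]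
    · rw [ha2 i, hb2 i, one_mul]
    · intro k _ hk
      rcases lt_or_gt_of_ne hk with h | h
      · rw [ha1 (show (id k : Fin n) < id i from h), zero_mul]
      · rw [hb1 (show (id i : Fin n) < id k from h), mul_zero]
    · intro h
      exact absurd (Finset.mem_univ i) h
  inv_mem' := by
    intro a ha
    refine inv_mem_of_one_mem_of_mul_mem
      (S := {A : GL (Fin n) F | (A : Matrix (Fin n) (Fin n) F).BlockTriangular id ∧
        ∀ i, (A : Matrix (Fin n) (Fin n) F) i i = 1})
      ⟨Matrix.blockTriangular_one, fun i => Matrix.one_apply_eq i⟩ ?_ ha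
    rintro x y ⟨hx1, hx2⟩ ⟨hy1, hy2⟩
    refine ⟨by simpa [Units.val_mul] using hx1.mul hy1, ?_⟩
    intro i
    rw [Units.val_mul, Matrix.mul_apply]
    rw [Finset.sum_eq_single i]
    · rw [hx2 i, hy2 i, one_mul]
    · intro k _ hk
      rcases lt_or_gt_of_ne hk with h | h
      · rw [hx1 (show (id k : Fin n) < id i from h), zero_mul]
      · rw [hy1 (show (id i : Fin n) < id k from h), mul_zero]
    · intro h
      exact absurd (Finset.mem_univ i) h

end GLBasics

section CommonEigenvectors

open Polynomial

variable {K M : Type*} [Field K] [AddCommGroup M] [Module K M]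

lemma splits_X_pow_prime_sub_one {p : ℕ} (hp : p.Prime)
    (hK : ringChar K ≠ p → ∃ ζ : K, IsPrimitiveRoot ζ p) : (X ^ p - C (1 : K)).Splits := by
  by_cases h : ringChar K = p
  · have : CharP K p := ringChar.of_eq h
    have : Fact p.Prime := ⟨hp⟩
    have : (X ^ p - C (1 : K)) = (X - C 1) ^ p := by
      rw [sub_pow_char, ← C_pow, one_pow]
    rw [this]
    exact (Splits.X_sub_C 1).pow p
  · obtain ⟨ζ, hζ⟩ := hK h
    exact X_pow_sub_one_splits hζ

lemma exists_eigenvector_of_aeval_prod_eq_zero (T : Module.End K M) (N : Submodule K M)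
    (hT : ∀ x ∈ N, T x ∈ N) (S : Multiset K) :
    ∀ x ∈ N, x ≠ 0 → aeval T (S.map fun μ => X - C μ).prod x = 0 →
      ∃ μ : K, ∃ y ∈ N, y ≠ 0 ∧ T y = μ • y := by
  induction S using Multiset.induction_on with
  | empty =>
    intro x _ hx0 hx
    exact absurd (by simpa using hx) hx0
  | cons μ S ih =>
    intro x hxN hx0 hx
    by_cases h : T x - μ • x = 0
    · exact ⟨μ, x, hxN, hx0, sub_eq_zero.mp h⟩
    · refine ih _ (N.sub_mem (hT x hxN) (N.smul_mem μ hxN)) h ?_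
      rw [Multiset.map_cons, Multiset.prod_cons, mul_comm, map_mul, Module.End.mul_apply] at hx
      simpa [Module.algebraMap_end_apply] using hx

lemma exists_eigenvector_of_pow_eq_one {p : ℕ} (hp : p ≠ 0)
    (hsplit : (X ^ p - C (1 : K)).Splits) (T : Module.End K M) (hTp : T ^ p = 1)
    (N : Submodule K M) (hN : N ≠ ⊥) (hT : ∀ x ∈ N, T x ∈ N) :
    ∃ μ : K, ∃ y ∈ N, y ≠ 0 ∧ T y = μ • y := by
  obtain ⟨x, hxN, hx0⟩ := N.ne_bot_iff.mp hN
  refine exists_eigenvector_of_aeval_prod_eq_zero T N hT (X ^ p - C (1 : K)).roots x hxN hx0 ?_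
  rw [← hsplit.eq_prod_roots_of_monic (monic_X_pow_sub_C _ hp)]
  simp [hTp]

/-- A finite family of commuting operators of exponent `p` acts by scalars on a nonzero
invariant subspace. -/
lemma exists_submodule_scalar {p : ℕ} (hp : p ≠ 0) (hsplit : (X ^ p - C (1 : K)).Splits)
    {ι : Type*} (T : ι → Module.End K M) (hcomm : ∀ i j x, T i (T j x) = T j (T i x))
    (hTp : ∀ i, T i ^ p = 1) (N : Submodule K M) (hN : N ≠ ⊥)
    (hT : ∀ i, ∀ x ∈ N, T i x ∈ N) (s : Finset ι) :
    ∃ N' ≤ N, N' ≠ ⊥ ∧ (∀ i, ∀ x ∈ N', T i x ∈ N') ∧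
      ∀ i ∈ s, ∃ μ : K, ∀ x ∈ N', T i x = μ • x := by
  classical
  induction s using Finset.induction_on with
  | empty => exact ⟨N, le_rfl, hN, hT, by simp⟩
  | insert i s _ ih =>
    obtain ⟨W, hWN, hW0, hWT, hWs⟩ := ih
    obtain ⟨μ, y, hyW, hy0, hy⟩ :=
      exists_eigenvector_of_pow_eq_one hp hsplit (T i) (hTp i) W hW0 (hWT i)
    refine ⟨W ⊓ LinearMap.ker (T i - μ • 1), inf_le_left.trans hWN,
      Submodule.ne_bot_iff _ |>.mpr ⟨y, ⟨hyW, by simp [hy]⟩, hy0⟩, ?_, ?_⟩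
    · rintro j x ⟨hxW, hx⟩
      refine ⟨hWT j x hxW, ?_⟩
      have hx' : T i x = μ • x := by simpa [sub_eq_zero] using hx
      simp [hcomm i j, hx']
    · intro j hj
      rcases Finset.mem_insert.mp hj with rfl | hj
      · exact ⟨μ, fun x hx => by simpa [sub_eq_zero] using hx.2⟩
      · obtain ⟨ν, hν⟩ := hWs j hj
        exact ⟨ν, fun x hx => hν x hx.1⟩

/-- A finite additive group of exponent `p` acting on a nonzero space has an eigenvector whose
eigenvalues form an additive character. -/
lemma exists_addChar_eigenvector {p : ℕ} (hp : p ≠ 0) (hsplit : (X ^ p - C (1 : K)).Splits)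
    {A : Type*} [AddCommGroup A] [Finite A] (hA : ∀ a : A, p • a = 0)
    (c : AddChar A (Module.End K M)) (N : Submodule K M) (hN : N ≠ ⊥)
    (hc : ∀ a, ∀ x ∈ N, c a x ∈ N) :
    ∃ χ : AddChar A K, ∃ x ∈ N, x ≠ 0 ∧ ∀ a, c a x = χ a • x := by
  cases nonempty_fintype A
  obtain ⟨W, hWN, hW0, -, hW⟩ := exists_submodule_scalar hp hsplit c
    (fun a b x => by
      rw [← Module.End.mul_apply, ← Module.End.mul_apply, ← c.map_add_eq_mul, add_comm,
        c.map_add_eq_mul])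
    (fun a => by rw [← c.map_nsmul_eq_pow, hA, c.map_zero_eq_one]) N hN hc Finset.univ
  obtain ⟨x, hxW, hx0⟩ := W.ne_bot_iff.mp hW0
  choose μ hμ using fun a => hW a (Finset.mem_univ a)
  refine ⟨⟨μ, ?_, fun a b => ?_⟩, x, hWN hxW, hx0, fun a => hμ a x hxW⟩
  · refine smul_left_injective K hx0 ?_
    simp [← hμ 0 x hxW]
  · refine smul_left_injective K hx0 ?_
    simp only [← hμ (a + b) x hxW, c.map_add_eq_mul, Module.End.mul_apply, hμ b x hxW, map_smul,
      hμ a x hxW, smul_smul, mul_comm]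

end CommonEigenvectors

section Duality

variable {F K : Type*} [Field F] [Finite F] [Field K]

/-- Over a finite field, every additive character is a shift of a given nontrivial one. -/
lemma exists_mulShift_eq {ψ : AddChar F K} (hψ : ψ ≠ 1) (θ : AddChar F K) :
    ∃ r : F, ψ.mulShift r = θ := by
  classical
  cases nonempty_fintype F
  have hli : LinearIndependent K fun χ : AddChar F K => (χ : F → K) := by
    have h := (linearIndependent_monoidHom (Multiplicative F) K).comp
      (AddChar.toMonoidHomEquiv : AddChar F K ≃ _) (Equiv.injective _)
    exact h
  have : Fintype (AddChar F K) := @Fintype.ofFinite _ hli.finite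
  have hcard : Fintype.card (AddChar F K) ≤ Fintype.card F := by
    simpa only [Module.finrank_fintype_fun_eq_card] using hli.fintype_card_le_finrank
  have hinj := AddChar.to_mulShift_inj_of_isPrimitive (AddChar.IsPrimitive.of_ne_one hψ)
  exact ((Fintype.bijective_iff_injective_and_card _).mpr
    ⟨hinj, (Fintype.card_le_of_injective _ hinj).antisymm hcard⟩).surjective θ

lemma AddChar.map_finset_sum {ι A M : Type*} [AddCommMonoid A] [CommMonoid M] (χ : AddChar A M)
    (s : Finset ι) (f : ι → A) : χ (∑ i ∈ s, f i) = ∏ i ∈ s, χ (f i) :=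
  map_prod χ.toMonoidHom (fun i => Multiplicative.ofAdd (f i)) s

lemma exists_addChar_eq_dotProduct {ι : Type*} [Fintype ι] (χ : AddChar (ι → F) K) :
    ∃ (ψ : AddChar F K) (r : ι → F), ∀ a, χ a = ψ (r ⬝ᵥ a) := by
  classical
  let θ : ι → AddChar F K := fun i => χ.compAddMonoidHom (AddMonoidHom.single (fun _ => F) i)
  have hχ : ∀ a, χ a = ∏ i, θ i (a i) := by
    intro a
    have h : χ (∑ i, Pi.single i (a i)) = ∏ i, χ (Pi.single i (a i)) := χ.map_finset_sum _ _
    rw [Finset.univ_sum_single] at h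
    exact h
  by_cases h : ∃ i, θ i ≠ 1
  · obtain ⟨i, hi⟩ := h
    choose r hr using fun j => exists_mulShift_eq hi (θ j)
    refine ⟨θ i, r, fun a => ?_⟩
    rw [hχ, dotProduct, AddChar.map_finset_sum]
    exact Finset.prod_congr rfl fun j _ => by rw [← hr j, AddChar.mulShift_apply]
  · push Not at h
    exact ⟨1, 0, fun a => by simp [hχ, h]⟩

end Duality

section Matrices

variable {F : Type*} [Field F] {n : ℕ}

/-- The invertible matrix `1 + u wᵀ`, where `wᵀ u = 0`. -/
def oneAddVecMulVec (u w : Fin n → F) (h : w ⬝ᵥ u = 0) : GL (Fin n) F where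
  val := 1 + vecMulVec u w
  inv := 1 - vecMulVec u w
  val_inv := by simp [add_mul, mul_sub, vecMulVec_mul_vecMulVec, h]
  inv_val := by simp [sub_mul, mul_add, vecMulVec_mul_vecMulVec, h]

/-- Replace the coordinates of index at least `m` by zero. -/
def truncate (m : ℕ) (a : Fin n → F) : Fin n → F := fun i => if (i : ℕ) < m then a i else 0

lemma truncate_of_lt {m : ℕ} (a : Fin n → F) {i : Fin n} (h : (i : ℕ) < m) :
    truncate m a i = a i := if_pos h

lemma truncate_of_le {m : ℕ} (a : Fin n → F) {i : Fin n} (h : m ≤ (i : ℕ)) :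
    truncate m a i = 0 := if_neg h.not_gt

lemma truncate_eq_self {m : ℕ} {a : Fin n → F} (h : ∀ i : Fin n, m ≤ (i : ℕ) → a i = 0) :
    truncate m a = a := by
  ext i
  rcases lt_or_ge (i : ℕ) m with hi | hi
  · exact truncate_of_lt a hi
  · rw [truncate_of_le a hi, h i hi]

lemma dotProduct_truncate (m : ℕ) (r a : Fin n → F) :
    r ⬝ᵥ truncate m a = truncate m r ⬝ᵥ a := by
  refine Finset.sum_congr rfl fun i _ => ?_
  simp only [truncate]
  split_ifs <;> simp

/-- The unitriangular matrices which differ from `1` in column `k` only, parametrised by that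
column. -/
def columnChar (k : Fin n) : AddChar (Fin n → F) (GL (Fin n) F) where
  toFun a := oneAddVecMulVec (truncate k a) (Pi.single k 1) (by simp [truncate])
  map_zero_eq_one' := by
    ext i j
    simp [oneAddVecMulVec, truncate, vecMulVec_apply]
  map_add_eq_mul' a b := by
    have h : truncate k (a + b) = truncate k a + truncate k b := by
      ext i
      simp only [truncate, Pi.add_apply]
      split_ifs <;> simp
    apply Units.ext
    simp [oneAddVecMulVec, add_mul, mul_add, vecMulVec_mul_vecMulVec, h, add_vecMulVec,
      truncate, add_assoc, add_comm]

lemma columnChar_coe (k : Fin n) (a : Fin n → F) :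
    (columnChar k a : Matrix (Fin n) (Fin n) F) =
      1 + vecMulVec (truncate k a) (Pi.single k 1) := rfl

lemma columnChar_truncate (k : Fin n) (a : Fin n → F) :
    columnChar k (truncate k a) = columnChar k a := by
  apply Units.ext
  rw [columnChar_coe, columnChar_coe,
    truncate_eq_self (a := truncate k a) fun i hi => truncate_of_le a hi]

lemma mulVec_apply_eq_self {A : Matrix (Fin n) (Fin n) F} {i : Fin n}
    (hA : ∀ j ≤ i, A i j = (1 : Matrix (Fin n) (Fin n) F) i j) {a : Fin n → F}
    (ha : ∀ j, i < j → a j = 0) : (A *ᵥ a) i = a i := by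
  rw [mulVec, dotProduct, Finset.sum_eq_single i]
  · simp [hA i le_rfl]
  · intro j _ hj
    rcases lt_or_gt_of_ne hj with h | h
    · rw [hA j h.le, one_apply_ne hj.symm, zero_mul]
    · rw [ha j h, mul_zero]
  · simp

variable (F n) in
/-- The set underlying `rowUnitriangular`. -/
def rowUnitriangularSet (m : ℕ) : Set (GL (Fin n) F) :=
  {g | ∀ i j : Fin n, m ≤ (i : ℕ) → j ≤ i →
    (g : Matrix (Fin n) (Fin n) F) i j = (1 : Matrix (Fin n) (Fin n) F) i j}

lemma one_mem_rowUnitriangularSet (m : ℕ) : 1 ∈ rowUnitriangularSet F n m := fun _ _ _ _ => rfl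

lemma mul_mem_rowUnitriangularSet {m : ℕ} {g h : GL (Fin n) F}
    (hg : g ∈ rowUnitriangularSet F n m) (hh : h ∈ rowUnitriangularSet F n m) :
    g * h ∈ rowUnitriangularSet F n m := by
  intro i j hi hj
  rw [← hh i j hi hj, Units.val_mul]
  refine mulVec_apply_eq_self (A := g) (a := fun l => h l j) (fun l hl => hg i l hi hl)
    fun l hl => ?_
  rw [hh l j (hi.trans hl.le) (hj.trans hl.le), one_apply_ne (hj.trans_lt hl).ne']

variable (F n) in
/-- The invertible matrices whose rows of index at least `m` are those of a unitriangular
matrix. -/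
def rowUnitriangular [Finite F] (m : ℕ) : Subgroup (GL (Fin n) F) where
  carrier := rowUnitriangularSet F n m
  one_mem' := one_mem_rowUnitriangularSet m
  mul_mem' := mul_mem_rowUnitriangularSet
  inv_mem' := inv_mem_of_one_mem_of_mul_mem (one_mem_rowUnitriangularSet m)
    mul_mem_rowUnitriangularSet

/-- The unitriangular matrices whose columns of index less than `m` are those of `1`. -/
def IsColumnUnitriangular (m : ℕ) (g : GL (Fin n) F) : Prop :=
  ∀ i j : Fin n, ((j : ℕ) < m ∨ j ≤ i) →
    (g : Matrix (Fin n) (Fin n) F) i j = (1 : Matrix (Fin n) (Fin n) F) i j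

section

variable [Finite F]

lemma rowUnitriangular_mono {l m : ℕ} (h : l ≤ m) :
    rowUnitriangular F n l ≤ rowUnitriangular F n m :=
  fun _ hg i j hi hj => hg i j (h.trans hi) hj

lemma IsColumnUnitriangular.mem_rowUnitriangular {m : ℕ} {g : GL (Fin n) F}
    (hg : IsColumnUnitriangular m g) (l : ℕ) : g ∈ rowUnitriangular F n l :=
  fun i j _ hj => hg i j (Or.inr hj)

lemma columnChar_mem_rowUnitriangular (k : Fin n) (a : Fin n → F) :
    columnChar k a ∈ rowUnitriangular F n k := by
  intro i j hi _
  simp [columnChar_coe, vecMulVec_apply, truncate_of_le a hi]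

lemma mulVec_apply_of_mem_rowUnitriangular {m : ℕ} {g : GL (Fin n) F}
    (hg : g ∈ rowUnitriangular F n m) {i : Fin n} (hi : m ≤ (i : ℕ)) {a : Fin n → F}
    (ha : ∀ j, i < j → a j = 0) : ((g : Matrix (Fin n) (Fin n) F) *ᵥ a) i = a i :=
  mulVec_apply_eq_self (fun j hj => hg i j hi hj) ha

lemma columnChar_mul {k : Fin n} {t : GL (Fin n) F} (ht : t ∈ rowUnitriangular F n k)
    (hrow : (t : Matrix (Fin n) (Fin n) F) k = Pi.single k 1) (a : Fin n → F) :
    columnChar k a * t =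
      t * columnChar k (((t⁻¹ : GL (Fin n) F) : Matrix (Fin n) (Fin n) F) *ᵥ truncate k a) := by
  have htr : truncate k (((t⁻¹ : GL (Fin n) F) : Matrix (Fin n) (Fin n) F) *ᵥ truncate k a) =
      ((t⁻¹ : GL (Fin n) F) : Matrix (Fin n) (Fin n) F) *ᵥ truncate k a := by
    refine truncate_eq_self fun i hi => ?_
    rw [mulVec_apply_of_mem_rowUnitriangular (inv_mem ht) hi, truncate_of_le a hi]
    exact fun j hj => truncate_of_le a (hi.trans hj.le)
  apply Units.ext
  rw [Units.val_mul, Units.val_mul, columnChar_coe, columnChar_coe, htr, add_mul, mul_add,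
    vecMulVec_mul, mul_vecMulVec, mulVec_mulVec, ← Units.val_mul, mul_inv_cancel, single_one_vecMul]
  simp [Matrix.row, hrow]

/-- A nonzero row supported on the first `m` coordinates occurs in an invertible matrix whose rows
of index at least `m` are those of `1`. -/
lemma exists_mem_rowUnitriangular_row_eq {m : ℕ} {l : Fin n} (hl : (l : ℕ) < m) {r : Fin n → F}
    (hr : ∀ j : Fin n, m ≤ (j : ℕ) → r j = 0) (hr0 : r ≠ 0) :
    ∃ h ∈ rowUnitriangular F n m, (h : Matrix (Fin n) (Fin n) F) l = r ∧
      ∀ i : Fin n, m ≤ (i : ℕ) → (h : Matrix (Fin n) (Fin n) F) i = Pi.single i 1 := by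
  obtain ⟨i, hi⟩ := Function.ne_iff.mp hr0
  have him : (i : ℕ) < m := by
    by_contra h
    exact hi (hr i (not_lt.mp h))
  let A : Matrix (Fin n) (Fin n) F :=
    ((1 : Matrix (Fin n) (Fin n) F).updateRow i r).submatrix (Equiv.swap i l) id
  have hA : A.det ≠ 0 := by
    rw [det_permute, ← cramer_transpose_apply, transpose_one, cramer_one]
    have hs : ((Equiv.Perm.sign (Equiv.swap i l) : ℤ) : F) ≠ 0 := by
      rcases Int.units_eq_one_or (Equiv.Perm.sign (Equiv.swap i l)) with h | h <;> simp [h]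
    exact mul_ne_zero hs hi
  have hrow : ∀ j : Fin n, m ≤ (j : ℕ) → A j = Pi.single j 1 := by
    intro j hj
    have hji : j ≠ i := by rintro rfl; omega
    have hjl : j ≠ l := by rintro rfl; omega
    ext s
    simp [A, Equiv.swap_apply_of_ne_of_ne hji hjl, updateRow_ne hji, one_apply, Pi.single_apply,
      eq_comm]
  refine ⟨GeneralLinearGroup.mkOfDetNeZero A hA, fun j s hj _ => ?_, ?_, hrow⟩
  · change A j s = _
    rw [hrow j hj, one_apply, Pi.single_apply]
    simp [eq_comm]
  · change A l = r
    ext s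
    simp [A]

/-- Row `k` becomes trivial after right division by a unitriangular matrix which differs from `1`
in this row only. -/
lemma exists_mul_eq_row_eq_single {m : ℕ} {k : Fin n} (hk : m ≤ (k : ℕ)) {g : GL (Fin n) F}
    (hg : g ∈ rowUnitriangular F n m) :
    ∃ t ∈ rowUnitriangular F n m, ∃ y : GL (Fin n) F, IsColumnUnitriangular (k + 1) y ∧
      (t : Matrix (Fin n) (Fin n) F) k = Pi.single k 1 ∧ g = t * y := by
  let r : Fin n → F := fun j => if k < j then g k j else 0
  let y : GL (Fin n) F := oneAddVecMulVec (Pi.single k 1) r (by simp [r])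
  have hy : IsColumnUnitriangular (k + 1) y := by
    intro i j hij
    change (1 + vecMulVec (Pi.single k 1) r) i j = _
    by_cases hik : i = k
    · subst hik
      have hr : r j = 0 := if_neg (by
        rcases hij with h | h
        · exact not_lt.mpr (Nat.lt_succ_iff.mp h)
        · exact not_lt.mpr h)
      simp [vecMulVec_apply, hr]
    · simp [vecMulVec_apply, hik]
  refine ⟨g * y⁻¹, mul_mem hg (inv_mem (hy.mem_rowUnitriangular m)), y, hy, ?_, by group⟩
  ext j
  change ((g : Matrix (Fin n) (Fin n) F) * (1 - vecMulVec (Pi.single k 1) r)) k j = _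
  rw [mul_sub, mul_one, mul_vecMulVec, Matrix.sub_apply, vecMulVec_apply]
  rcases lt_or_ge k j with h | h
  · simp [r, h, hg k k hk le_rfl, h.ne']
  · simp [r, h.not_gt, hg k j hk h, one_apply, Pi.single_apply, eq_comm]

end

/-- A unitriangular matrix trivial in the columns before `k` is the product of one which differs
from `1` in column `k` only and one trivial in all columns up to `k`. -/
lemma IsColumnUnitriangular.exists_eq_columnChar_mul {k : Fin n} {w : GL (Fin n) F}
    (hw : IsColumnUnitriangular k w) :
    ∃ a, ∃ w', IsColumnUnitriangular (k + 1) w' ∧ w = columnChar k a * w' := by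
  let a : Fin n → F := fun i => w i k
  refine ⟨a, (columnChar k a)⁻¹ * w, fun i j hij => ?_, by group⟩
  change ((1 - vecMulVec (truncate k a) (Pi.single k 1)) * (w : Matrix (Fin n) (Fin n) F)) i j = _
  rw [sub_mul, one_mul, vecMulVec_mul, Matrix.sub_apply, vecMulVec_apply, single_one_vecMul]
  change w i j - truncate k a i * w k j = _
  rcases lt_trichotomy j k with h | rfl | h
  · rw [hw k j (Or.inl h), one_apply_ne h.ne', mul_zero, sub_zero, hw i j (Or.inl h)]
  · rw [hw j j (Or.inr le_rfl), one_apply_eq, mul_one]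
    rcases lt_or_ge i j with hi | hi
    · rw [truncate_of_lt a hi, one_apply_ne hi.ne, sub_self]
    · rw [truncate_of_le a hi, sub_zero, hw i j (Or.inr hi)]
  · have hji : j ≤ i := hij.resolve_left fun h' => by
      have : (k : ℕ) < j := h
      omega
    rw [truncate_of_le a (h.le.trans hji), zero_mul, sub_zero, hw i j (Or.inr hji)]

end Matrices

section Descent

open Polynomial

variable {F K M : Type*} [Field F] [Finite F] [Field K] [AddCommGroup M] [Module K M] {n : ℕ}

/-- A nonzero subspace stable under `rowUnitriangular F n m` on which the unitriangular matrices
trivial in the columns of index at most `m` act by scalars. -/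
structure IsWhittakerSubspace (ρ : GL (Fin n) F →* Module.End K M) (m : ℕ)
    (N : Submodule K M) : Prop where
  ne_bot : N ≠ ⊥
  stable : ∀ g ∈ rowUnitriangular F n m, ∀ x ∈ N, ρ g x ∈ N
  scalar : ∀ w, IsColumnUnitriangular (m + 1) w → ∃ μ : K, ∀ x ∈ N, ρ w x = μ • x

variable {ρ : GL (Fin n) F →* Module.End K M} {N : Submodule K M} {p : ℕ}

/-- There is an eigenvector for column `k` whose character depends on a single, prescribed
coordinate. -/
lemma exists_columnChar_eigenvector (hp : p ≠ 0) (hsplit : (X ^ p - C (1 : K)).Splits)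
    (hpF : (p : F) = 0) {k l : Fin n} (hl : l < k) (hN : N ≠ ⊥)
    (hstable : ∀ g ∈ rowUnitriangular F n k, ∀ x ∈ N, ρ g x ∈ N) :
    ∃ ψ : AddChar F K, ∃ x ∈ N, x ≠ 0 ∧ ∀ a, ρ (columnChar k a) x = ψ (a l) • x := by
  obtain ⟨χ, x, hxN, hx0, hx⟩ := exists_addChar_eigenvector hp hsplit
    (A := Fin n → F) (fun a => by ext i; simp [hpF]) (ρ.compAddChar (columnChar k)) N hN
    (fun a => hstable _ (columnChar_mem_rowUnitriangular k a))
  have hx : ∀ a, ρ (columnChar k a) x = χ a • x := hx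
  obtain ⟨ψ, r, hr⟩ := exists_addChar_eq_dotProduct χ
  have hχ : ∀ a, χ a = ψ (truncate k r ⬝ᵥ a) := fun a => by
    rw [← dotProduct_truncate, ← hr]
    refine smul_left_injective K hx0 ?_
    simp only [← hx, columnChar_truncate]
  by_cases hr0 : truncate k r = 0
  · exact ⟨1, x, hxN, hx0, fun a => by rw [hx, hχ, hr0]; simp⟩
  obtain ⟨h, hh, hhl, hhrow⟩ := exists_mem_rowUnitriangular_row_eq hl
    (fun j hj => truncate_of_le r hj) hr0
  replace hhl : (h : Matrix (Fin n) (Fin n) F) l = truncate k r := hhl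
  refine ⟨ψ, ρ h x, hstable h hh x hxN, fun h0 => hx0 ?_, fun a => ?_⟩
  · have := congrArg (ρ h⁻¹) h0
    rwa [← Module.End.mul_apply, ← map_mul, inv_mul_cancel, map_one, map_zero] at this
  · rw [← Module.End.mul_apply, ← map_mul, columnChar_mul hh (hhrow k le_rfl), map_mul,
      Module.End.mul_apply, hx, map_smul, hχ, ← hhl]
    congr 2
    change ((h : Matrix (Fin n) (Fin n) F) *ᵥ
      (((h⁻¹ : GL (Fin n) F) : Matrix (Fin n) (Fin n) F) *ᵥ truncate k a)) l = a l
    rw [mulVec_mulVec, ← Units.val_mul, mul_inv_cancel, Units.val_one, one_mulVec,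
      truncate_of_lt a hl]

lemma IsWhittakerSubspace.exists_pred (hp : p ≠ 0) (hsplit : (X ^ p - C (1 : K)).Splits)
    (hpF : (p : F) = 0) {m : ℕ} (hm : m + 1 < n) (hN : IsWhittakerSubspace ρ (m + 1) N) :
    ∃ N', IsWhittakerSubspace ρ m N' := by
  let k : Fin n := ⟨m + 1, hm⟩
  let l : Fin n := ⟨m, (Nat.lt_succ_self m).trans hm⟩
  have hl : l < k := Nat.lt_succ_self m
  obtain ⟨ψ, x, hxN, hx0, hx⟩ :=
    exists_columnChar_eigenvector (k := k) hp hsplit hpF hl hN.ne_bot hN.stable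
  let N' : Submodule K M := N ⊓ ⨅ a, LinearMap.ker (ρ (columnChar k a) - ψ (a l) • 1)
  have hN' : ∀ y, y ∈ N' ↔ y ∈ N ∧ ∀ a, ρ (columnChar k a) y = ψ (a l) • y := fun y => by
    simp [N', Submodule.mem_iInf, sub_eq_zero]
  refine ⟨N', N'.ne_bot_iff.mpr ⟨x, (hN' x).mpr ⟨hxN, hx⟩, hx0⟩, ?_, ?_⟩
  · intro g hg y hy
    rw [hN'] at hy
    obtain ⟨t, ht, u, hu, htk, rfl⟩ := exists_mul_eq_row_eq_single (k := k) (Nat.le_succ m) hg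
    obtain ⟨μ, hμ⟩ := hN.scalar u hu
    have ht' : t ∈ rowUnitriangular F n k := rowUnitriangular_mono (Nat.le_succ m) ht
    rw [map_mul, Module.End.mul_apply, hμ y hy.1, map_smul]
    refine N'.smul_mem μ ((hN' _).mpr ⟨hN.stable t ht' y hy.1, fun a => ?_⟩)
    rw [← Module.End.mul_apply, ← map_mul, columnChar_mul ht' htk, map_mul,
      Module.End.mul_apply, hy.2, map_smul,
      mulVec_apply_of_mem_rowUnitriangular (inv_mem ht) (i := l) le_rfl, truncate_of_lt a hl]
    exact fun j hj => truncate_of_le a (Nat.succ_le_of_lt hj)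
  · intro w hw
    obtain ⟨a, u, hu, rfl⟩ := IsColumnUnitriangular.exists_eq_columnChar_mul (k := k) hw
    obtain ⟨μ, hμ⟩ := hN.scalar u hu
    refine ⟨μ * ψ (a l), fun y hy => ?_⟩
    rw [hN'] at hy
    rw [map_mul, Module.End.mul_apply, hμ y hy.1, map_smul, hy.2, smul_smul]

lemma exists_isWhittakerSubspace [Nontrivial M] (hp : p ≠ 0)
    (hsplit : (X ^ p - C (1 : K)).Splits) (hpF : (p : F) = 0) (hn : 1 ≤ n)
    (ρ : GL (Fin n) F →* Module.End K M) : ∃ N, IsWhittakerSubspace ρ 0 N := by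
  refine Nat.decreasingInduction' (m := 0) (n := n - 1)
    (P := fun m => ∃ N, IsWhittakerSubspace ρ m N)
    (fun m hm _ ⟨N, hN⟩ => hN.exists_pred hp hsplit hpF (by omega)) (Nat.zero_le _)
    ⟨⊤, top_ne_bot, fun _ _ _ _ => trivial, fun w hw => ⟨1, fun x _ => ?_⟩⟩
  have : w = 1 := by
    ext i j
    exact hw i j (Or.inl (by omega))
  simp [this]

end Descent

/-- Every nonzero module over `K` for `G(n) = GL_n(F_q)` has a
one-dimensional `K`-subspace invariant under the unitriangular subgroup `U(n)`. -/
theorem statement_0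
    (p m q : ℕ) (hp : p.Prime) (hm : 0 < m) (hq : q = p ^ m)
    (F : Type) [Field F] [Fintype F] [DecidableEq F] (hF : Fintype.card F = q)
    (n : ℕ) (hn : 1 ≤ n)
    (K : Type) [Field K] (hK : ringChar K ≠ p → ∃ ζ : K, IsPrimitiveRoot ζ p)
    (M : Type) [AddCommGroup M] [Module K M]
    [Module (MonoidAlgebra K (GL (Fin n) F)) M]
    [IsScalarTower K (MonoidAlgebra K (GL (Fin n) F)) M]
    (hM : Nontrivial M) :
    ∃ L : Submodule K M, (∃ v : M, v ≠ 0 ∧ L = Submodule.span K {v}) ∧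
      ∀ u : (UT F n), ∀ x ∈ L,
        (MonoidAlgebra.of K (GL (Fin n) F) (u : GL (Fin n) F)) • x ∈ L := by
  have hpF : (p : F) = 0 := by
    have h : ((Fintype.card F : ℕ) : F) = 0 := FiniteField.cast_card_eq_zero F
    rw [hF, hq, Nat.cast_pow] at h
    exact pow_eq_zero_iff hm.ne' |>.mp h
  let ρ : GL (Fin n) F →* Module.End K M :=
    (Algebra.lsmul K K M : MonoidAlgebra K (GL (Fin n) F) →ₐ[K] Module.End K M).toMonoidHom.comp
      (MonoidAlgebra.of K (GL (Fin n) F))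
  obtain ⟨N, hN⟩ := exists_isWhittakerSubspace hp.ne_zero
    (splits_X_pow_prime_sub_one hp hK) hpF hn ρ
  obtain ⟨v, hvN, hv0⟩ := N.ne_bot_iff.mp hN.ne_bot
  refine ⟨Submodule.span K {v}, ⟨v, hv0, rfl⟩, fun u x hx => ?_⟩
  have hu : IsColumnUnitriangular 1 (u : GL (Fin n) F) := by
    intro i j hij
    have hji : j ≤ i := hij.elim (fun h => Fin.le_def.mpr (by omega)) id
    rcases hji.lt_or_eq with h | rfl
    · rw [u.2.1 h, Matrix.one_apply_ne h.ne']
    · rw [u.2.2 j, Matrix.one_apply_eq]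
  obtain ⟨μ, hμ⟩ := hN.scalar u hu
  have hxN : x ∈ N := (Submodule.span_singleton_le_iff_mem v N).mpr hvN hx
  change ρ u x ∈ _
  rw [hμ x hxN]
  exact Submodule.smul_mem _ μ hx
end

section
/- Let K be a field, G a group, and U a subgroup of G satisfying: (a) every nonzero KG-module has a one-dimensional U-invariant subspace; (b) whenever a KG-module has a one-dimensional U-invariant subspace on which U acts via the group homomorphism λ : U → K^*, it also has a one-dimensional U-invariant subspace on which U acts via λ^{-1}. Let M be a self-dual (hence finite-dimensional) KG-module such that M, viewed as a KU-module by restriction, has no repeated one-dimensional irreducible constituents (i.e., no linear character of U occurs with multiplicity at least two among the composition factors of M as a KU-module). Then M is a completely reducible and multiplicity-free KG-module, and every KG-submodule of M is self-dual. -/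
/-- A `KG`-module `M` (over a field `K`) is *self-dual* if it is isomorphic, as a
`KG`-module, to its dual space `M* = Hom_K(M, K)` equipped with the contragredient
action `(g·φ)(m) = φ(g⁻¹ m)`. -/
def IsSelfDualK (K G : Type*) [Field K] [Group G] (M : Type*) [AddCommGroup M]
    [Module K M] [Module (MonoidAlgebra K G) M]
    [IsScalarTower K (MonoidAlgebra K G) M] : Prop :=
  ∃ φ : M ≃ₗ[K] Module.Dual K M,
    ∀ (g : G) (m x : M),
      φ ((MonoidAlgebra.of K G g) • m) x = φ m ((MonoidAlgebra.of K G g⁻¹) • x)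

/-- The socle of a `KG`-module: the sum of all its irreducible submodules. -/
def socleMod (A M : Type*) [Ring A] [AddCommGroup M] [Module A M] : Submodule A M :=
  sSup {S : Submodule A M | IsSimpleModule A S}

/-- The subquotient `q / p` associated with a pair of submodules (normally `p ≤ q`). -/
abbrev sectionMod {A M : Type*} [Ring A] [AddCommGroup M] [Module A M]
    (p q : Submodule A M) : Type _ :=
  q ⧸ (p.comap q.subtype)

/-- A module is *multiplicity free* if in any composition series (from `⊥` to `⊤`)
the factors are pairwise non-isomorphic. -/
def MultiplicityFree (A M : Type*) [Ring A] [AddCommGroup M] [Module A M] : Prop :=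
  ∀ s : CompositionSeries (Submodule A M), s.head = ⊥ → s.last = ⊤ →
    ∀ i j : Fin s.length, i ≠ j →
      ¬ Nonempty ((sectionMod (s i.castSucc) (s i.succ)) ≃ₗ[A]
          (sectionMod (s j.castSucc) (s j.succ)))

section GroupAlgebraModules

variable {K : Type*} [Field K] {G : Type*} [Group G]
  {M : Type*} [AddCommGroup M] [Module K M] [Module (MonoidAlgebra K G) M]
  [IsScalarTower K (MonoidAlgebra K G) M]

/-- Group elements commute with scalars. -/
lemma of_smul_smul_comm (g : G) (c : K) (x : M) :
    MonoidAlgebra.of K G g • (c • x) = c • (MonoidAlgebra.of K G g • x) := by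
  rw [← algebraMap_smul (MonoidAlgebra K G) c x, ← algebraMap_smul (MonoidAlgebra K G) c, smul_smul,
    smul_smul, Algebra.commutes]

/-- A line invariant under a subgroup `U` affords a linear character of `U`. -/
lemma exists_character_of_invariant_line {U : Subgroup G} {v : M} (hv : v ≠ 0)
    (h : ∀ u : U, MonoidAlgebra.of K G (u : G) • v ∈ Submodule.span K {v}) :
    ∃ lam : U →* Kˣ, ∀ u : U,
      MonoidAlgebra.of K G (u : G) • v = ((lam u : Kˣ) : K) • v := by
  choose c hc using fun u => Submodule.mem_span_singleton.1 (h u)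
  have inj : ∀ {a b : K}, a • v = b • v → a = b := fun hab => smul_left_injective K hv hab
  let f : U →* K :=
    { toFun := c
      map_one' := inj (by rw [hc, one_smul, OneMemClass.coe_one, map_one, one_smul])
      map_mul' := fun a b => inj (by
        rw [hc, mul_comm, mul_smul, hc, Subgroup.coe_mul, map_mul, mul_smul, ← hc b,
          of_smul_smul_comm]) }
  exact ⟨f.toHomUnits, fun u => (hc u).symm⟩

/-- An eigenvector of `U` in a section `q / p` lifts to an eigenvector modulo `p`. -/
lemma exists_lift_of_section_eigenvector {U : Subgroup G} (lam : U →* Kˣ)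
    {p q : Submodule (MonoidAlgebra K G) M} {v : sectionMod p q} (hv : v ≠ 0)
    (h : ∀ u : U, MonoidAlgebra.of K G (u : G) • v = ((lam u : Kˣ) : K) • v) :
    ∃ x ∈ q, x ∉ p ∧
      ∀ u : U, MonoidAlgebra.of K G (u : G) • x - ((lam u : Kˣ) : K) • x ∈ p := by
  obtain ⟨x, rfl⟩ := Submodule.Quotient.mk_surjective _ v
  refine ⟨x, x.2, fun hx => hv ((Submodule.Quotient.mk_eq_zero _).2 hx), fun u => ?_⟩
  have := h u
  rw [← Submodule.Quotient.mk_smul, ← Submodule.Quotient.mk_smul, Submodule.Quotient.eq] at this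
  exact this

/-- The submodule generated over `K` by a `KG`-submodule and an eigenvector modulo it
is stable under `U`. -/
lemma of_smul_mem_sup_span {U : Subgroup G} {lam : U →* Kˣ}
    {p : Submodule (MonoidAlgebra K G) M} {x : M}
    (h : ∀ u : U, MonoidAlgebra.of K G (u : G) • x - ((lam u : Kˣ) : K) • x ∈ p)
    (u : U) {y : M} (hy : y ∈ p.restrictScalars K ⊔ Submodule.span K {x}) :
    MonoidAlgebra.of K G (u : G) • y ∈ p.restrictScalars K ⊔ Submodule.span K {x} := by
  obtain ⟨n, hn, z, hz, rfl⟩ := Submodule.mem_sup.1 hy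
  obtain ⟨c, rfl⟩ := Submodule.mem_span_singleton.1 hz
  rw [smul_add, of_smul_smul_comm]
  refine add_mem (Submodule.mem_sup_left (p.smul_mem _ hn)) (Submodule.smul_mem _ _ ?_)
  rw [← sub_add_cancel (MonoidAlgebra.of K G (u : G) • x) (((lam u : Kˣ) : K) • x)]
  exact add_mem (Submodule.mem_sup_left (h u))
    (Submodule.mem_sup_right (Submodule.smul_mem _ _ (Submodule.mem_span_singleton_self x)))

/-- The left orthogonal of a `KG`-submodule with respect to an invariant form. -/
def leftOrthogonal (B : M →ₗ[K] Module.Dual K M)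
    (hB : ∀ (g : G) (m x : M),
      B (MonoidAlgebra.of K G g • m) x = B m (MonoidAlgebra.of K G g⁻¹ • x))
    (N : Submodule (MonoidAlgebra K G) M) : Submodule (MonoidAlgebra K G) M :=
  MonoidAlgebra.submoduleOfSMulMem
    { carrier := {m | ∀ n ∈ N, B m n = 0}
      zero_mem' := by simp
      add_mem' := fun ha hb n hn => by simp [ha n hn, hb n hn]
      smul_mem' := fun c a ha n hn => by simp [ha n hn] }
    fun g m hm n hn => by
      rw [hB]
      exact hm _ (N.smul_mem _ hn)

lemma mem_leftOrthogonal {B : M →ₗ[K] Module.Dual K M}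
    {hB : ∀ (g : G) (m x : M),
      B (MonoidAlgebra.of K G g • m) x = B m (MonoidAlgebra.of K G g⁻¹ • x)}
    {N : Submodule (MonoidAlgebra K G) M} {m : M} :
    m ∈ leftOrthogonal B hB N ↔ ∀ n ∈ N, B m n = 0 := Iff.rfl

/-- If an invariant form is nondegenerate on the submodule `N`, it induces a `K`-linear
isomorphism from `N` to its dual. -/
lemma bijective_restrict_of_inf_leftOrthogonal_eq_bot [FiniteDimensional K M]
    {B : M →ₗ[K] Module.Dual K M}
    {hB : ∀ (g : G) (m x : M),
      B (MonoidAlgebra.of K G g • m) x = B m (MonoidAlgebra.of K G g⁻¹ • x)}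
    {N : Submodule (MonoidAlgebra K G) M} (h : N ⊓ leftOrthogonal B hB N = ⊥) :
    Function.Bijective
      ((N.restrictScalars K).subtype.dualMap ∘ₗ B ∘ₗ (N.restrictScalars K).subtype) := by
  set f := (N.restrictScalars K).subtype.dualMap ∘ₗ B ∘ₗ (N.restrictScalars K).subtype with hf
  have inj : Function.Injective f := by
    rw [injective_iff_map_eq_zero]
    intro a ha
    have hmem : (a : M) ∈ N ⊓ leftOrthogonal B hB N :=
      ⟨a.2, fun n hn => by simpa [hf] using LinearMap.congr_fun ha ⟨n, hn⟩⟩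
    rw [h] at hmem
    exact Subtype.ext hmem
  exact ⟨inj, (LinearMap.injective_iff_surjective_of_finrank_eq_finrank
    Subspace.dual_finrank_eq.symm).1 inj⟩

end GroupAlgebraModules

/-- If every nonzero `KG`-module has a one-dimensional `U`-invariant
subspace, and linear characters of `U` occurring in `KG`-modules occur together with
their inverses, then every self-dual `KG`-module with no repeated one-dimensional
`U`-constituents is completely reducible and multiplicity free, and all its submodules
are self-dual. -/
theorem statement_3
    (K : Type) [Field K] (G : Type) [Group G] (U : Subgroup G)
    (ha : ∀ (V : Type) [AddCommGroup V] [Module K V]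
        [Module (MonoidAlgebra K G) V] [IsScalarTower K (MonoidAlgebra K G) V],
        Nontrivial V →
        ∃ L : Submodule K V, (∃ v : V, v ≠ 0 ∧ L = Submodule.span K {v}) ∧
          ∀ u : U, ∀ x ∈ L, (MonoidAlgebra.of K G (u : G)) • x ∈ L)
    (hb : ∀ (V : Type) [AddCommGroup V] [Module K V]
        [Module (MonoidAlgebra K G) V] [IsScalarTower K (MonoidAlgebra K G) V]
        (lam : U →* Kˣ),
        (∃ v : V, v ≠ 0 ∧ ∀ u : U,
          (MonoidAlgebra.of K G (u : G)) • v = ((lam u : Kˣ) : K) • v) →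
        (∃ w : V, w ≠ 0 ∧ ∀ u : U,
          (MonoidAlgebra.of K G (u : G)) • w = (((lam u)⁻¹ : Kˣ) : K) • w))
    (M : Type) [AddCommGroup M] [Module K M] [Module (MonoidAlgebra K G) M]
    [IsScalarTower K (MonoidAlgebra K G) M]
    (hself : IsSelfDualK K G M)
    (hnorep : ∀ (lam : U →* Kˣ) (N₁ L₁ N₂ L₂ : Submodule K M),
      (∀ u : U, ∀ x ∈ N₁, (MonoidAlgebra.of K G (u : G)) • x ∈ N₁) →
      (∀ u : U, ∀ x ∈ L₁, (MonoidAlgebra.of K G (u : G)) • x ∈ L₁) →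
      (∀ u : U, ∀ x ∈ N₂, (MonoidAlgebra.of K G (u : G)) • x ∈ N₂) →
      (∀ u : U, ∀ x ∈ L₂, (MonoidAlgebra.of K G (u : G)) • x ∈ L₂) →
      N₁ ≤ L₁ → L₁ ≤ N₂ → N₂ ≤ L₂ →
      (∃ x ∈ L₁, x ∉ N₁ ∧ L₁ ≤ N₁ ⊔ Submodule.span K {x} ∧
        ∀ u : U, (MonoidAlgebra.of K G (u : G)) • x - ((lam u : Kˣ) : K) • x ∈ N₁) →
      (∃ x ∈ L₂, x ∉ N₂ ∧ L₂ ≤ N₂ ⊔ Submodule.span K {x} ∧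
        ∀ u : U, (MonoidAlgebra.of K G (u : G)) • x - ((lam u : Kˣ) : K) • x ∈ N₂) →
      False) :
    IsSemisimpleModule (MonoidAlgebra K G) M ∧
    MultiplicityFree (MonoidAlgebra K G) M ∧
    ∀ N : Submodule (MonoidAlgebra K G) M, IsSelfDualK K G ↥N := by
  have eigen : ∀ (V : Type) [AddCommGroup V] [Module K V] [Module (MonoidAlgebra K G) V]
      [IsScalarTower K (MonoidAlgebra K G) V], Nontrivial V →
      ∃ (lam : U →* Kˣ) (v : V), v ≠ 0 ∧ ∀ u : U,
        MonoidAlgebra.of K G (u : G) • v = ((lam u : Kˣ) : K) • v := by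
    intro V _ _ _ _ hV
    obtain ⟨L, ⟨v, hv, rfl⟩, hL⟩ := ha V hV
    obtain ⟨lam, hlam⟩ := exists_character_of_invariant_line hv
      fun u => hL u v (Submodule.mem_span_singleton_self v)
    exact ⟨lam, v, hv, hlam⟩
  obtain ⟨φ, hφ⟩ := hself
  have : FiniteDimensional K M := Basis.linearEquiv_dual_iff_finiteDimensional.1 ⟨φ⟩
  have isotropic : ∀ R : Submodule (MonoidAlgebra K G) M,
      (∀ a ∈ R, ∀ b ∈ R, φ a b = 0) → R = ⊥ := by
    intro R hR
    by_contra hne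
    obtain ⟨lam, v, hv, hvl⟩ := eigen R (Submodule.nontrivial_iff_ne_bot.2 hne)
    obtain ⟨w, hw, hwl⟩ := hb R lam ⟨v, hv, hvl⟩
    have hv0 : (v : M) ≠ 0 := fun h => hv (Subtype.ext h)
    have hw0 : (w : M) ≠ 0 := fun h => hw (Subtype.ext h)
    have hvl' : ∀ u : U, MonoidAlgebra.of K G (u : G) • (v : M) = ((lam u : Kˣ) : K) • (v : M) :=
      fun u => congrArg Subtype.val (hvl u)
    have hwl' : ∀ u : U, MonoidAlgebra.of K G (u : G) • (w : M)
        = (((lam u)⁻¹ : Kˣ) : K) • (w : M) := fun u => congrArg Subtype.val (hwl u)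
    have act : ∀ (u : U) (x : M), φ w (MonoidAlgebra.of K G (u : G) • x)
        = ((lam u : Kˣ) : K) * φ w x := by
      intro u x
      have h1 := hφ ((u⁻¹ : U) : G) w x
      rw [hwl' u⁻¹, map_inv, inv_inv] at h1
      simpa using h1.symm
    obtain ⟨x, hx⟩ : ∃ x, φ w x = 1 := by
      have hne : φ w ≠ 0 := fun h => hw0 (by simpa using h)
      exact LinearMap.surjective hne 1
    refine hnorep lam ⊥ (Submodule.span K {(v : M)}) (LinearMap.ker (φ w)) ⊤ ?_ ?_ ?_ ?_
      bot_le ?_ le_top ⟨v, Submodule.mem_span_singleton_self _, by simpa using hv0, le_sup_right, ?_⟩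
      ⟨x, trivial, by simp [hx], ?_, ?_⟩
    · intro u x hx
      rw [Submodule.mem_bot] at hx ⊢
      rw [hx, smul_zero]
    · intro u x hx
      obtain ⟨c, rfl⟩ := Submodule.mem_span_singleton.1 hx
      rw [of_smul_smul_comm, hvl' u, smul_smul]
      exact Submodule.smul_mem _ _ (Submodule.mem_span_singleton_self _)
    · intro u x hx
      rw [LinearMap.mem_ker] at hx ⊢
      rw [act, hx, mul_zero]
    · exact fun _ _ _ => trivial
    · rw [Submodule.span_singleton_le_iff_mem, LinearMap.mem_ker]
      exact hR w w.2 v v.2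
    · intro u
      rw [hvl' u, sub_self]
      exact zero_mem _
    · intro y _
      rw [← sub_add_cancel y (φ w y • x)]
      refine add_mem (Submodule.mem_sup_left ?_) (Submodule.mem_sup_right
        (Submodule.smul_mem _ _ (Submodule.mem_span_singleton_self x)))
      simp [hx]
    · intro u
      rw [LinearMap.mem_ker, map_sub, act, map_smul, smul_eq_mul, sub_self]
  have radical : ∀ N : Submodule (MonoidAlgebra K G) M,
      N ⊓ leftOrthogonal (φ : M →ₗ[K] Module.Dual K M) hφ N = ⊥ :=
    fun N => isotropic _ fun a ha b hb => ha.2 b hb.1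
  have bij := fun N => bijective_restrict_of_inf_leftOrthogonal_eq_bot (radical N)
  refine ⟨?_, ?_, ?_⟩
  · rw [isSemisimpleModule_iff]
    refine ⟨fun N => ⟨leftOrthogonal (φ : M →ₗ[K] Module.Dual K M) hφ N,
      disjoint_iff.2 (radical N), codisjoint_iff.2 (eq_top_iff.2 fun m _ => ?_)⟩⟩
    obtain ⟨n, hn⟩ := (bij N).2 ((φ m).comp (N.restrictScalars K).subtype)
    rw [← add_sub_cancel (n : M) m]
    refine add_mem (Submodule.mem_sup_left n.2) (Submodule.mem_sup_right ?_)
    rw [mem_leftOrthogonal]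
    intro y hy
    have hny : φ n y = φ m y := LinearMap.congr_fun hn ⟨y, hy⟩
    simp [hny]
  · intro s _ _
    suffices key : ∀ i j : Fin s.length, i < j →
        ¬ Nonempty ((sectionMod (s i.castSucc) (s i.succ)) ≃ₗ[MonoidAlgebra K G]
          (sectionMod (s j.castSucc) (s j.succ))) by
      intro i j hij hne
      rcases lt_or_gt_of_ne hij with h | h
      · exact key i j h hne
      · exact key j i h (hne.map LinearEquiv.symm)
    rintro i j hij ⟨f⟩
    have hlt : s i.castSucc < s i.succ := s.strictMono i.castSucc_lt_succ
    have hle : s i.succ ≤ s j.castSucc := s.strictMono.monotone (Fin.succ_le_castSucc_iff.2 hij)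
    have hnt : Nontrivial (sectionMod (s i.castSucc) (s i.succ)) := by
      rw [Submodule.Quotient.nontrivial_iff, Ne, Submodule.comap_subtype_eq_top]
      exact hlt.not_ge
    obtain ⟨lam, v, hv, hvl⟩ := eigen _ hnt
    obtain ⟨x, hxq, hxp, hx⟩ := exists_lift_of_section_eigenvector lam hv hvl
    obtain ⟨y, -, hyp, hy⟩ := exists_lift_of_section_eigenvector lam (v := f v) (by simpa using hv)
      fun u => by rw [← map_smul, hvl u]; exact f.toLinearMap.map_smul_of_tower _ _
    have mem_right : ∀ (p : Submodule (MonoidAlgebra K G) M) (z : M),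
        z ∈ p.restrictScalars K ⊔ Submodule.span K {z} := fun _ z =>
      Submodule.mem_sup_right (Submodule.mem_span_singleton_self z)
    refine hnorep lam ((s i.castSucc).restrictScalars K)
      ((s i.castSucc).restrictScalars K ⊔ Submodule.span K {x})
      ((s j.castSucc).restrictScalars K)
      ((s j.castSucc).restrictScalars K ⊔ Submodule.span K {y})
      (fun u z hz => (s i.castSucc).smul_mem _ hz) (fun u z hz => of_smul_mem_sup_span hx u hz)
      (fun u z hz => (s j.castSucc).smul_mem _ hz) (fun u z hz => of_smul_mem_sup_span hy u hz)
      le_sup_left (sup_le (fun z hz => hle (hlt.le hz)) ?_) le_sup_left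
      ⟨x, mem_right _ x, hxp, le_rfl, hx⟩ ⟨y, mem_right _ y, hyp, le_rfl, hy⟩
    rw [Submodule.span_singleton_le_iff_mem]
    exact hle hxq
  · exact fun N => ⟨LinearEquiv.ofBijective _ (bij N), fun g m x => hφ g m x⟩
end
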